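/- For every positive integer r and every integer n ≥ 2, in ℤ[q] one has ∑_{σ ∈ K_{r,n}} q^{exc^Abs(σ)} (−1)^{cyc(σ)} = 0, where K_{r,n} = {σ = (z,τ) ∈ G_{r,n} : τ(n) ≠ n and τ(n−1) ≠ n}. -/

import Mathlib

open Finset Polynomial

/-- Number of excedances of a permutation: #{i : τ(i) > i}. -/
def exc {n : ℕ} (τ : Equiv.Perm (Fin n)) : ℕ :=
  (Finset.univ.filter fun i => i < τ i).card

/-- Number of cycles of a permutation, counting fixed points as cycles. -/
def cyc {n : ℕ} (τ : Equiv.Perm (Fin n)) : ℕ :=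
  Multiset.card τ.cycleType + (Finset.univ.filter fun i => τ i = i).card

/-- Color sum of a colored permutation. -/
def csum {r n : ℕ} (z : Fin n → Fin r) : ℕ := ∑ i, (z i : ℕ)

/-- #{i : z_i = 0 and τ(i) > i}. -/
def excA {r n : ℕ} (z : Fin n → Fin r) (τ : Equiv.Perm (Fin n)) : ℕ :=
  (Finset.univ.filter fun i => (z i : ℕ) = 0 ∧ i < τ i).card

/-- Excedance number with respect to the absolute order. -/
def excAbs {r n : ℕ} (z : Fin n → Fin r) (τ : Equiv.Perm (Fin n)) : ℕ :=
  exc τ + csum z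

/-- Excedance number with respect to the color order. -/
def excClr {r n : ℕ} (z : Fin n → Fin r) (τ : Equiv.Perm (Fin n)) : ℕ :=
  r * excA z τ + csum z

/-- The parity of the number of cycles is governed by the sign of the permutation. -/
theorem neg_one_pow_cyc {n : ℕ} (τ : Equiv.Perm (Fin n)) :
    (-1 : ℤˣ) ^ cyc τ = (-1) ^ n * Equiv.Perm.sign τ := by
  have hfix : (univ.filter fun i => τ i = i).card + τ.support.card = n := by
    simpa [Equiv.Perm.support] using
      card_filter_add_card_filter_not (s := (univ : Finset (Fin n))) (fun i => τ i = i)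
  have hsq : (-1 : ℤˣ) ^ τ.support.card * (-1) ^ τ.support.card = 1 :=
    Int.units_mul_self _
  have hpow : (-1 : ℤˣ) ^ n =
      (-1) ^ (univ.filter fun i => τ i = i).card * (-1) ^ τ.support.card := by
    rw [← pow_add, hfix]
  rw [Equiv.Perm.sign_of_cycleType, Equiv.Perm.sum_cycleType, cyc, hpow, pow_add, pow_add,
    mul_assoc, ← mul_assoc ((-1 : ℤˣ) ^ τ.support.card), hsq, one_mul, mul_comm]

/-- Composing with a transposition changes the parity of the number of cycles. -/
theorem neg_one_pow_cyc_mul_swap {R : Type*} [Ring R] {n : ℕ} (τ : Equiv.Perm (Fin n))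
    {a b : Fin n} (hab : a ≠ b) :
    (-1 : R) ^ cyc (τ * Equiv.swap a b) = -(-1) ^ cyc τ := by
  have h : (-1 : ℤˣ) ^ cyc (τ * Equiv.swap a b) = (-1) ^ (cyc τ + 1) := by
    rw [pow_succ, neg_one_pow_cyc, neg_one_pow_cyc, Equiv.Perm.sign_mul,
      Equiv.Perm.sign_swap hab, mul_assoc]
  have hR := congrArg (fun u : ℤˣ => ((u : ℤ) : R)) h
  push_cast at hR
  rw [hR, pow_succ, mul_neg_one]

/-- Exchanging the values at two positions that are not excedances, before or after the exchange,
preserves the number of excedances. -/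
theorem exc_mul_swap {n : ℕ} (τ : Equiv.Perm (Fin n)) {a b : Fin n}
    (haa : τ a ≤ a) (hab : τ a ≤ b) (hba : τ b ≤ a) (hbb : τ b ≤ b) :
    exc (τ * Equiv.swap a b) = exc τ := by
  unfold exc
  congr 1
  ext i
  rw [mem_filter_univ, mem_filter_univ, Equiv.Perm.mul_apply]
  rcases eq_or_ne i a with rfl | hia
  · simp [haa.not_gt, hba.not_gt]
  rcases eq_or_ne i b with rfl | hib
  · simp [hab.not_gt, hbb.not_gt]
  · rw [Equiv.swap_apply_of_ne_of_ne hia hib]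

theorem stmt15 (r n : ℕ) (hr : 0 < r) (hn : 2 ≤ n) :
    ∑ σ ∈ Finset.univ.filter
        (fun σ : (Fin n → Fin r) × Equiv.Perm (Fin n) =>
          σ.2 ⟨n - 1, by omega⟩ ≠ ⟨n - 1, by omega⟩ ∧
          σ.2 ⟨n - 2, by omega⟩ ≠ ⟨n - 1, by omega⟩),
      (X : Polynomial ℤ) ^ excAbs σ.1 σ.2 * (-1) ^ cyc σ.2 = 0 := by
  have hne : (⟨n - 2, by omega⟩ : Fin n) ≠ ⟨n - 1, by omega⟩ := by
    simp only [ne_eq, Fin.mk.injEq]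
    omega
  have hlast (x : Fin n) : x ≤ ⟨n - 1, by omega⟩ := by
    rw [Fin.le_def]
    have := x.isLt
    simp only
    omega
  have hpenult (x : Fin n) (hx : x ≠ ⟨n - 1, by omega⟩) : x ≤ ⟨n - 2, by omega⟩ := by
    rw [Fin.le_def]
    rw [ne_eq, Fin.ext_iff] at hx
    have := x.isLt
    simp only at hx ⊢
    omega
  refine sum_involution
    (fun σ _ => (σ.1, σ.2 * Equiv.swap ⟨n - 2, by omega⟩ ⟨n - 1, by omega⟩)) ?_ ?_ ?_ ?_
  · rintro ⟨z, τ⟩ hσ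
    obtain ⟨h1, h2⟩ := (mem_filter.mp hσ).2
    simp only [excAbs]
    rw [neg_one_pow_cyc_mul_swap τ hne,
      exc_mul_swap τ (hpenult _ h2) (hlast _) (hpenult _ h1) (hlast _)]
    ring
  · rintro ⟨z, τ⟩ _ _ heq
    exact hne (Equiv.swap_eq_one_iff.mp (mul_eq_left.mp (congrArg Prod.snd heq)))
  · rintro ⟨z, τ⟩ hσ
    obtain ⟨h1, h2⟩ := (mem_filter.mp hσ).2
    simpa using And.intro h2 h1
  · rintro ⟨z, τ⟩ _
    simp [mul_assoc]
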